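/- Let Ω ⊂ ℝⁿ be a bounded open set with smooth boundary, φ a limiting Carleman weight on a neighborhood of the closure of Ω, A a C¹ real vector field on the closure and q ∈ L^∞(Ω). Then there exist C > 0 and h₀ > 0 such that for all 0 < h ≤ h₀ and all u ∈ C_c^∞(Ω): ‖e^{φ/h} u‖_{L²} + h‖e^{φ/h} ∇u‖_{L²} ≤ C h ‖e^{φ/h} L_{A,q} u‖_{L²}. -/

import Mathlib

open MeasureTheory Complex
open scoped RealInnerProductSpace

noncomputable section

abbrev En (n : ℕ) := EuclideanSpace ℝ (Fin n)

def pd {n : ℕ} (j : Fin n) (f : En n → ℂ) (x : En n) : ℂ :=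
  fderiv ℝ f x (EuclideanSpace.single j 1)

def pdR {n : ℕ} (j : Fin n) (f : En n → ℝ) (x : En n) : ℝ :=
  fderiv ℝ f x (EuclideanSpace.single j 1)

def hess {n : ℕ} (φ : En n → ℝ) (x v w : En n) : ℝ :=
  fderiv ℝ (fun y => fderiv ℝ φ y v) x w

/-- Magnetic Schrödinger operator `L_{A,q} = Σ_j (D_j + A_j)² + q`, `D = -i∇`. -/
def Lmag {n : ℕ} (A : En n → En n) (q : En n → ℂ) (u : En n → ℂ) (x : En n) : ℂ :=
  -(∑ j, pd j (pd j u) x) - 2 * I * (∑ j, (A x j : ℂ) * pd j u x)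
    - I * (∑ j, (pdR j (fun y => A y j) x : ℂ)) * u x
    + (((∑ j, (A x j) ^ 2 : ℝ) : ℂ) + q x) * u x


section aux
variable {n : ℕ}

lemma pdR_smooth {f : En n → ℝ} (hf : ContDiff ℝ (⊤ : ℕ∞) f) (j : Fin n) :
    ContDiff ℝ (⊤ : ℕ∞) (pdR j f) := by
  unfold pdR
  exact (hf.fderiv_right (m := (⊤ : ℕ∞)) (by simp)).clm_apply contDiff_const

lemma smooth_diff {f : En n → ℝ} (hf : ContDiff ℝ (⊤ : ℕ∞) f) : Differentiable ℝ f :=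
  hf.differentiable (by simp)

lemma pdR_mul {f g : En n → ℝ} (hf : ContDiff ℝ (⊤ : ℕ∞) f) (hg : ContDiff ℝ (⊤ : ℕ∞) g)
    (j : Fin n) (x : En n) :
    pdR j (fun y => f y * g y) x = f x * pdR j g x + g x * pdR j f x := by
  unfold pdR
  rw [fderiv_fun_mul (smooth_diff hf x) (smooth_diff hg x)]
  simp

lemma pdR_add {f g : En n → ℝ} (hf : ContDiff ℝ (⊤ : ℕ∞) f) (hg : ContDiff ℝ (⊤ : ℕ∞) g)
    (j : Fin n) (x : En n) :
    pdR j (fun y => f y + g y) x = pdR j f x + pdR j g x := by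
  unfold pdR
  rw [fderiv_fun_add (smooth_diff hf x) (smooth_diff hg x)]
  simp

lemma pdR_const_mul {f : En n → ℝ} (hf : ContDiff ℝ (⊤ : ℕ∞) f) (c : ℝ)
    (j : Fin n) (x : En n) :
    pdR j (fun y => c * f y) x = c * pdR j f x := by
  unfold pdR
  rw [fderiv_const_mul (smooth_diff hf x)]
  simp

lemma pdR_const (c : ℝ) (j : Fin n) (x : En n) : pdR j (fun _ => c) x = 0 := by
  simp [pdR]

lemma pdR_sum {f : Fin n → En n → ℝ} (hf : ∀ k, ContDiff ℝ (⊤ : ℕ∞) (f k))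
    (j : Fin n) (x : En n) :
    pdR j (fun y => ∑ k, f k y) x = ∑ k, pdR j (f k) x := by
  unfold pdR
  rw [fderiv_fun_sum (fun k _ => smooth_diff (hf k) x)]
  simp

lemma pdR_comm {f : En n → ℝ} (hf : ContDiff ℝ (⊤ : ℕ∞) f) (j k : Fin n) (x : En n) :
    pdR j (pdR k f) x = pdR k (pdR j f) x := by
  have h : IsSymmSndFDerivAt ℝ f x := by
    apply (hf.contDiffAt (x := x)).isSymmSndFDerivAt
    simp only [minSmoothness_of_isRCLikeNormedField]
    exact WithTop.coe_le_coe.2 (le_top : (2:ℕ∞) ≤ ⊤)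
  have hd : DifferentiableAt ℝ (fderiv ℝ f) x :=
    ((hf.fderiv_right (m := (⊤ : ℕ∞)) (by simp)).differentiable (by simp)) x
  have key : ∀ a b : En n, fderiv ℝ (fun y => fderiv ℝ f y a) x b = fderiv ℝ (fderiv ℝ f) x b a := by
    intro a b
    rw [fderiv_clm_apply hd (differentiableAt_const _)]
    simp
  unfold pdR
  rw [key, key]
  exact h _ _

lemma pdR_tsupport {f : En n → ℝ} (j : Fin n) : tsupport (pdR j f) ⊆ tsupport f := by
  unfold pdR
  exact tsupport_fderiv_apply_subset ℝ _

lemma pdR_zero_of {f : En n → ℝ} (j : Fin n) {x : En n} (hx : x ∉ tsupport f) : pdR j f x = 0 := by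
  by_contra h
  exact hx (pdR_tsupport j (subset_tsupport _ h))

lemma integrable_of {f : En n → ℝ} (hf : ContDiff ℝ (⊤ : ℕ∞) f) (hc : HasCompactSupport f) :
    Integrable f := hf.continuous.integrable_of_hasCompactSupport hc

lemma integral_pdR {f : En n → ℝ} (hf : ContDiff ℝ (⊤ : ℕ∞) f) (hc : HasCompactSupport f)
    (j : Fin n) : Integrable (pdR j f) ∧ ∫ x, pdR j f x = 0 := by
  have hcj : HasCompactSupport (pdR j f) := hc.of_isClosed_subset (isClosed_tsupport _) (pdR_tsupport j)
  have hi := integrable_of (pdR_smooth hf j) hcj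
  refine ⟨hi, ?_⟩
  have := integral_mul_fderiv_eq_neg_fderiv_mul_of_integrable (μ := (volume : Measure (En n)))
    (f := fun _ => (1:ℝ)) (g := f) (v := EuclideanSpace.single j 1) (by simp)
    (by simp only [one_mul]; exact hi) (by simpa using integrable_of hf hc) (by simp)
    (fun x _ => smooth_diff hf x)
  simpa [pdR] using this

/-- functions that integrate to zero and vanish off `Ω` -/
def IsDiv (Ω : Set (En n)) (D : En n → ℝ) : Prop :=
  Integrable D ∧ (∫ x, D x) = 0 ∧ ∀ x, x ∉ Ω → D x = 0

lemma IsDiv.add {Ω : Set (En n)} {D E : En n → ℝ} (hD : IsDiv Ω D) (hE : IsDiv Ω E) :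
    IsDiv Ω (fun x => D x + E x) := by
  refine ⟨hD.1.add hE.1, ?_, fun x hx => by simp [hD.2.2 x hx, hE.2.2 x hx]⟩
  rw [integral_add hD.1 hE.1, hD.2.1, hE.2.1, add_zero]

lemma IsDiv.smul {Ω : Set (En n)} {D : En n → ℝ} (hD : IsDiv Ω D) (c : ℝ) :
    IsDiv Ω (fun x => c * D x) := by
  refine ⟨hD.1.const_mul c, ?_, fun x hx => by simp [hD.2.2 x hx]⟩
  rw [integral_const_mul, hD.2.1, mul_zero]

lemma isDiv_div {Ω : Set (En n)} {V : Fin n → En n → ℝ} {v : En n → ℝ}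
    (hV : ∀ j, ContDiff ℝ (⊤ : ℕ∞) (V j)) (hc : HasCompactSupport v) (hv : tsupport v ⊆ Ω)
    (hs : ∀ j x, x ∉ tsupport v → V j x = 0) :
    IsDiv Ω (fun x => ∑ j, pdR j (V j) x) := by
  have hsub : ∀ j, tsupport (V j) ⊆ tsupport v := fun j =>
    closure_minimal (fun x hx => by by_contra h; exact hx (hs j x h)) (isClosed_tsupport _)
  have hcj : ∀ j, HasCompactSupport (V j) := fun j =>
    hc.of_isClosed_subset (isClosed_tsupport _) (hsub j)
  refine ⟨integrable_finsetSum _ fun j _ => (integral_pdR (hV j) (hcj j) j).1, ?_, ?_⟩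
  · rw [integral_finsetSum _ fun j _ => (integral_pdR (hV j) (hcj j) j).1]
    exact Finset.sum_eq_zero fun j _ => (integral_pdR (hV j) (hcj j) j).2
  · intro x hx
    exact Finset.sum_eq_zero fun j _ => pdR_zero_of j fun h => hx (hv (hsub j h))

lemma alg1 (a p : Fin n → ℝ) (H W : Fin n → Fin n → ℝ) (hW : ∀ j k, W j k = W k j) (v : ℝ) :
    2 * ((∑ j, W j j) + (∑ j, p j * p j) * v) * (-2 * ∑ j, p j * a j)
    = 4 * (∑ j, ∑ k, H j k * a j * a k) + 4 * (∑ j, ∑ k, H j k * p j * p k) * v ^ 2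
      - 2 * (∑ j, H j j) * ((∑ j, a j * a j) - (∑ j, p j * p j) * v ^ 2)
      + ∑ j, (-4 * (W j j * (∑ k, p k * a k) + a j * ∑ k, (p k * W j k + a k * H j k))
        + 2 * (H j j * (∑ k, a k * a k) + p j * ∑ k, (a k * W j k + a k * W j k))
        - 2 * ((∑ k, (p k * H j k + p k * H j k)) * p j * v ^ 2 + (∑ k, p k * p k) * H j j * v ^ 2
          + (∑ k, p k * p k) * p j * (2 * v * a j))) := by
  have e1 : ∑ j, ∑ k, a j * (p k * W j k) = ∑ j, ∑ k, p j * (a k * W j k) := by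
    rw [Finset.sum_comm]
    refine Finset.sum_congr rfl fun j _ => Finset.sum_congr rfl fun k _ => ?_
    rw [hW k j]; ring
  have e2 : ∑ j, (a j * ∑ k, (p k * W j k + a k * H j k)) =
      (∑ j, ∑ k, p j * (a k * W j k)) + ∑ j, ∑ k, H j k * a j * a k := by
    rw [← e1, ← Finset.sum_add_distrib]
    refine Finset.sum_congr rfl fun j _ => ?_
    rw [Finset.mul_sum, ← Finset.sum_add_distrib]
    refine Finset.sum_congr rfl fun k _ => ?_
    ring
  have e3 : ∑ j, (p j * ∑ k, (a k * W j k + a k * W j k)) =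
      2 * (∑ j, ∑ k, p j * (a k * W j k)) := by
    rw [Finset.mul_sum]
    refine Finset.sum_congr rfl fun j _ => ?_
    rw [Finset.mul_sum, Finset.mul_sum]
    refine Finset.sum_congr rfl fun k _ => ?_
    ring
  have e4 : ∑ j, ((∑ k, (p k * H j k + p k * H j k)) * p j) =
      2 * (∑ j, ∑ k, H j k * p j * p k) := by
    rw [Finset.mul_sum]
    refine Finset.sum_congr rfl fun j _ => ?_
    rw [Finset.sum_mul, Finset.mul_sum]
    refine Finset.sum_congr rfl fun k _ => ?_
    ring
  have e5 : ∑ j, (-4 * (W j j * (∑ k, p k * a k) + a j * ∑ k, (p k * W j k + a k * H j k))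
        + 2 * (H j j * (∑ k, a k * a k) + p j * ∑ k, (a k * W j k + a k * W j k))
        - 2 * ((∑ k, (p k * H j k + p k * H j k)) * p j * v ^ 2 + (∑ k, p k * p k) * H j j * v ^ 2
          + (∑ k, p k * p k) * p j * (2 * v * a j)))
     = -4 * ((∑ j, W j j) * (∑ k, p k * a k) + ∑ j, (a j * ∑ k, (p k * W j k + a k * H j k)))
        + 2 * ((∑ j, H j j) * (∑ k, a k * a k) + ∑ j, (p j * ∑ k, (a k * W j k + a k * W j k)))
        - 2 * ((∑ j, ((∑ k, (p k * H j k + p k * H j k)) * p j)) * v ^ 2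
          + (∑ k, p k * p k) * (∑ j, H j j) * v ^ 2
          + (∑ k, p k * p k) * (∑ j, p j * a j) * (2 * v)) := by
    generalize (∑ k, p k * p k) = G
    generalize hP : (∑ k, p k * a k) = P
    generalize (∑ k, a k * a k) = E
    have hP2 : G * P * (2 * v) = ∑ j, G * p j * (2 * v * a j) := by
      rw [← hP, Finset.mul_sum, Finset.sum_mul]
      exact Finset.sum_congr rfl fun j _ => by ring
    rw [hP2]
    simp only [Finset.sum_add_distrib, Finset.sum_sub_distrib, ← Finset.mul_sum, ← Finset.sum_mul]
  rw [e5, e2, e3, e4]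
  ring

lemma ident1 {Ω : Set (En n)} {Ψ v : En n → ℝ} (hΨ : ContDiff ℝ (⊤ : ℕ∞) Ψ)
    (hv : ContDiff ℝ (⊤ : ℕ∞) v) (hc : HasCompactSupport v) (hs : tsupport v ⊆ Ω) :
    ∃ D, IsDiv Ω D ∧ ∀ x,
    2 * ((∑ j, pdR j (pdR j v) x) + (∑ j, pdR j Ψ x * pdR j Ψ x) * v x) *
      (-2 * ∑ j, pdR j Ψ x * pdR j v x)
    = 4 * (∑ j, ∑ k, pdR j (pdR k Ψ) x * pdR j v x * pdR k v x)
      + 4 * (∑ j, ∑ k, pdR j (pdR k Ψ) x * pdR j Ψ x * pdR k Ψ x) * v x ^ 2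
      - 2 * (∑ j, pdR j (pdR j Ψ) x) * ((∑ j, pdR j v x * pdR j v x)
          - (∑ j, pdR j Ψ x * pdR j Ψ x) * v x ^ 2)
      + D x := by
  have hvj := fun j => pdR_smooth hv j
  have hΨj := fun j => pdR_smooth hΨ j
  have hP : ContDiff ℝ (⊤ : ℕ∞) (fun y => ∑ k, pdR k Ψ y * pdR k v y) :=
    ContDiff.sum fun k _ => (hΨj k).mul (hvj k)
  have hE : ContDiff ℝ (⊤ : ℕ∞) (fun y => ∑ k, pdR k v y * pdR k v y) :=
    ContDiff.sum fun k _ => (hvj k).mul (hvj k)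
  have hG : ContDiff ℝ (⊤ : ℕ∞) (fun y => ∑ k, pdR k Ψ y * pdR k Ψ y) :=
    ContDiff.sum fun k _ => (hΨj k).mul (hΨj k)
  have h1 := fun j => (hvj j).mul hP
  have h2 := fun j => (hΨj j).mul hE
  have h3 := fun j => (hG.mul (hΨj j)).mul (hv.mul hv)
  refine ⟨_, isDiv_div (V := fun j y => (-4) * (pdR j v y * ∑ k, pdR k Ψ y * pdR k v y)
    + (2 * (pdR j Ψ y * ∑ k, pdR k v y * pdR k v y)
    + (-2) * (((∑ k, pdR k Ψ y * pdR k Ψ y) * pdR j Ψ y) * (v y * v y)))) ?_ hc hs ?_, ?_⟩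
  · intro j
    exact (contDiff_const.mul (h1 j)).add ((contDiff_const.mul (h2 j)).add (contDiff_const.mul (h3 j)))
  · intro j x hx
    have : v x = 0 := image_eq_zero_of_notMem_tsupport hx
    simp [pdR_zero_of _ hx, this]
  · intro x
    rw [alg1 _ _ (fun j k => pdR j (pdR k Ψ) x) (fun j k => pdR j (pdR k v) x)
      (fun j k => pdR_comm hv j k x)]
    congr 1
    refine Finset.sum_congr rfl fun j _ => ?_
    rw [pdR_add (contDiff_const.mul (h1 j))
      ((contDiff_const.mul (h2 j)).add (contDiff_const.mul (h3 j))),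
      pdR_add (contDiff_const.mul (h2 j)) (contDiff_const.mul (h3 j)),
      pdR_const_mul (h1 j), pdR_const_mul (h2 j), pdR_const_mul (h3 j),
      pdR_mul (hvj j) hP, pdR_mul (hΨj j) hE, pdR_mul (hG.mul (hΨj j)) (hv.mul hv),
      pdR_mul hG (hΨj j), pdR_mul hv hv,
      pdR_sum (fun k => (hΨj k).mul (hvj k)), pdR_sum (fun k => (hvj k).mul (hvj k)),
      pdR_sum (fun k => (hΨj k).mul (hΨj k))]
    simp only [pdR_mul (hΨj _) (hvj _), pdR_mul (hΨj _) (hΨj _), pdR_mul (hvj _) (hvj _)]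
    ring

/-- `div (μ v ∇v)` -/
lemma ident2 {Ω : Set (En n)} {μ v : En n → ℝ} (hμ : ContDiff ℝ (⊤ : ℕ∞) μ)
    (hv : ContDiff ℝ (⊤ : ℕ∞) v) (hc : HasCompactSupport v) (hs : tsupport v ⊆ Ω) :
    ∃ D, IsDiv Ω D ∧ ∀ x, D x =
      μ x * (∑ j, pdR j v x * pdR j v x) + μ x * v x * (∑ j, pdR j (pdR j v) x)
        + v x * ∑ j, pdR j μ x * pdR j v x := by
  have hvj := fun j => pdR_smooth hv j
  refine ⟨_, isDiv_div (V := fun j y => (μ y * v y) * pdR j v y) ?_ hc hs ?_, ?_⟩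
  · exact fun j => (hμ.mul hv).mul (hvj j)
  · intro j x hx
    simp [pdR_zero_of _ hx]
  · intro x
    simp only [pdR_mul (hμ.mul hv) (hvj _), pdR_mul hμ hv]
    simp only [Finset.mul_sum, ← Finset.sum_add_distrib]
    exact Finset.sum_congr rfl fun j _ => by ring

end aux

section core
variable {n : ℕ}

lemma scalar_ineq (c0 M s τ S T v E B F d g μ lam L D1 D2 D3 : ℝ)
    (hc0 : 0 < c0) (hM : 1 ≤ M) (hs1 : 1 ≤ s) (hs2 : M + 1 ≤ c0 * s)
    (hs3 : 168 * M ≤ c0 ^ 2 * s) (hτ : 32 * s * M ≤ τ)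
    (hl1 : τ / 2 ≤ lam) (hg : c0 ≤ g)
    (hE : 0 ≤ E)
    (hB : B ^ 2 ≤ M * E) (hμ : μ ^ 2 ≤ 16 * M * τ ^ 2)
    (hF : |v * F| ≤ 5 * M * τ ^ 2 * v ^ 2 + E)
    (hL : L ^ 2 ≤ 10 * M * τ ^ 2)
    (h1 : 2 * S * T = -μ * (E - lam ^ 2 * g * v ^ 2) - 2 * T * B + 4 * s * d ^ 2
      + 4 * s * lam ^ 2 * g ^ 2 * v ^ 2 + D1)
    (h2 : D2 = μ * E + μ * v * (S - lam ^ 2 * g * v) + v * F)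
    (h3 : D3 = E + v * (S - lam ^ 2 * g * v)) :
    s * min (c0 ^ 2 / 16) (c0 / 2) * (τ ^ 2 * v ^ 2 + E)
      + (1 / 2) * (D1 + ((-1) * D2 + (-(M + 1 + c0 * s)) * D3)) ≤ (S + T - L * v) ^ 2 := by
  set N := M + 1 + c0 * s with hN
  have hN2 : N ≤ 2 * c0 * s := by linarith
  have hN0 : 0 ≤ N := by positivity
  have hτ0 : 32 * s ≤ τ := by nlinarith
  have hτ2 : 32 * s ≤ τ ^ 2 := by nlinarith
  have hNN : N ^ 2 ≤ c0 ^ 2 * s * τ ^ 2 / 8 := by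
    have : N ^ 2 ≤ (2 * c0 * s) ^ 2 := pow_le_pow_left₀ hN0 hN2 2
    have h' : c0 ^ 2 * s * (32 * s) ≤ c0 ^ 2 * s * τ ^ 2 := by gcongr
    nlinarith
  have hlam : τ ^ 2 / 4 ≤ lam ^ 2 := by
    have : (τ / 2) ^ 2 ≤ lam ^ 2 := pow_le_pow_left₀ (by linarith) hl1 2
    nlinarith
  have hmain : c0 ^ 2 * s * τ ^ 2 / 2 ≤ lam ^ 2 * g * (4 * s * g - N) := by
    have a1 : 2 * s * c0 ≤ 4 * s * g - N := by nlinarith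
    have a2 : τ ^ 2 / 4 * c0 ≤ lam ^ 2 * g := by gcongr
    have a3 : τ ^ 2 / 4 * c0 * (2 * s * c0) ≤ lam ^ 2 * g * (4 * s * g - N) :=
      mul_le_mul a2 a1 (by positivity) (mul_nonneg (sq_nonneg _) (by linarith))
    linarith
  have hM3 : 168 * M * τ ^ 2 ≤ c0 ^ 2 * s * τ ^ 2 := by gcongr
  have hvF : -(5 * M * τ ^ 2 * v ^ 2 + E) ≤ v * F := by
    have := neg_abs_le (v * F); linarith
  -- lower bound for (S+T)^2
  have hμv : μ ^ 2 * v ^ 2 ≤ 16 * M * τ ^ 2 * v ^ 2 := by gcongr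
  have hkey : c0 ^ 2 * s * τ ^ 2 / 4 * v ^ 2 + c0 * s * E + (D1 + ((-1) * D2 + (-N) * D3))
      ≤ (S + T) ^ 2 := by
    have b1 : 0 ≤ (S / 2 + μ * v) ^ 2 := sq_nonneg _
    have b2 : 0 ≤ (S / 2 + N * v) ^ 2 := sq_nonneg _
    have b2' : 0 ≤ (S / 2 - N * v) ^ 2 := sq_nonneg _
    have b3 : 0 ≤ (T - B) ^ 2 := sq_nonneg _
    have b4 : 0 ≤ 4 * s * d ^ 2 := by positivity
    have b5 : (c0 ^ 2 * s * τ ^ 2 / 2) * v ^ 2 ≤ lam ^ 2 * g * (4 * s * g - N) * v ^ 2 := by gcongr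
    have b6 : N ^ 2 * v ^ 2 ≤ c0 ^ 2 * s * τ ^ 2 / 8 * v ^ 2 := by gcongr
    have b7 : 168 * M * τ ^ 2 * v ^ 2 ≤ c0 ^ 2 * s * τ ^ 2 * v ^ 2 := by gcongr
    have hNE : N * E = (M + 1) * E + c0 * s * E := by rw [hN]; ring
    have e : (S + T) ^ 2 = S ^ 2 + T ^ 2 + 2 * S * T := by ring
    rw [e, h1, h2, h3]
    linarith [sq_nonneg S]
  have hLv : L ^ 2 * v ^ 2 ≤ 10 * M * τ ^ 2 * v ^ 2 := by gcongr
  have b7 : 168 * M * τ ^ 2 * v ^ 2 ≤ c0 ^ 2 * s * τ ^ 2 * v ^ 2 := by gcongr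
  have hfin : c0 ^ 2 * s * τ ^ 2 / 16 * v ^ 2 + c0 * s / 2 * E
      + (1 / 2) * (D1 + ((-1) * D2 + (-N) * D3)) ≤ (S + T - L * v) ^ 2 := by
    generalize D1 + ((-1) * D2 + (-N) * D3) = X at hkey ⊢
    have e : (S + T - L * v) ^ 2 = (S + T) ^ 2 / 2 - L ^ 2 * v ^ 2
      + (S + T - 2 * (L * v)) ^ 2 / 2 := by ring
    have e' := sq_nonneg (S + T - 2 * (L * v))
    rw [e]
    have e0 : 0 ≤ M * τ ^ 2 * v ^ 2 := by positivity
    linarith only [hkey, hLv, b7, e', e0]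
  refine le_trans ?_ hfin
  have m1 : s * min (c0 ^ 2 / 16) (c0 / 2) * (τ ^ 2 * v ^ 2) ≤ s * (c0 ^ 2 / 16) * (τ ^ 2 * v ^ 2) := by
    gcongr; exact min_le_left _ _
  have m2 : s * min (c0 ^ 2 / 16) (c0 / 2) * E ≤ s * (c0 / 2) * E := by
    gcongr; exact min_le_right _ _
  linarith

set_option maxHeartbeats 1000000 in
lemma core_real {Ω : Set (En n)} {Φ m : En n → ℝ} {b : Fin n → En n → ℝ} {c0 M : ℝ}
    (hΦ : ContDiff ℝ (⊤ : ℕ∞) Φ) (hm : ContDiff ℝ (⊤ : ℕ∞) m)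
    (hc0 : 0 < c0) (hM : 1 ≤ M)
    (hH : ∀ x ∈ Ω, ∀ X : Fin n → ℝ, ∑ j, ∑ k, pdR j (pdR k Φ) x * X j * X k
      = - m x * (∑ j, X j * X j) + (∑ j, pdR j Φ x * X j) * (∑ j, b j x * X j))
    (hN : ∀ x ∈ Ω, ∑ j, ∑ k, pdR j (pdR k Φ) x * pdR j Φ x * pdR k Φ x
      = m x * ∑ j, pdR j Φ x * pdR j Φ x)
    (hg : ∀ x ∈ Ω, c0 ≤ ∑ j, pdR j Φ x * pdR j Φ x)
    (hgM : ∀ x ∈ Ω, (∑ j, pdR j Φ x * pdR j Φ x) ^ 2 ≤ M)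
    (hΦM : ∀ x ∈ Ω, |Φ x| ≤ M)
    (hbM : ∀ x ∈ Ω, ∑ j, b j x ^ 2 ≤ M)
    (hΔM : ∀ x ∈ Ω, (∑ j, pdR j (pdR j Φ) x) ^ 2 ≤ M)
    (hpM : ∀ x ∈ Ω, (4 * m x + 2 * ∑ j, pdR j (pdR j Φ) x) ^ 2 ≤ M)
    (hpjM : ∀ x ∈ Ω, ∑ i, (pdR i (fun y => 4 * m y + 2 * ∑ j, pdR j (pdR j Φ) y) x) ^ 2 ≤ M)
    (hrjM : ∀ x ∈ Ω, ∑ i, (pdR i Φ x * (4 * m x + 2 * ∑ j, pdR j (pdR j Φ) x)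
      + 2 * pdR i (fun y => ∑ j, pdR j Φ y * pdR j Φ y) x) ^ 2 ≤ M)
    (s τ : ℝ) (hs1 : 1 ≤ s) (hs2 : M + 1 ≤ c0 * s)
    (hs3 : 168 * M ≤ c0 ^ 2 * s) (hτ : 32 * s * M ≤ τ) 
    (v Ψ : En n → ℝ) (hΨ : Ψ = fun x => τ * Φ x + (s / 2) * (Φ x * Φ x))
    (hv : ContDiff ℝ (⊤ : ℕ∞) v) (hc : HasCompactSupport v) (hs : tsupport v ⊆ Ω) :
    ∃ D, IsDiv Ω D ∧ ∀ x ∈ Ω,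
      s * min (c0 ^ 2 / 16) (c0 / 2) * (τ ^ 2 * v x ^ 2 + ∑ j, pdR j v x * pdR j v x) + D x
      ≤ ((∑ j, pdR j (pdR j v) x) + (∑ j, pdR j Ψ x * pdR j Ψ x) * v x
        + (-2 * ∑ j, pdR j Ψ x * pdR j v x) - (∑ j, pdR j (pdR j Ψ) x) * v x) ^ 2 := by
  have hΦj := fun j => pdR_smooth hΦ j
  have hΦjk := fun j k => pdR_smooth (hΦj k) j
  have hlamS : ContDiff ℝ (⊤ : ℕ∞) (fun x => τ + s * Φ x) := contDiff_const.add (contDiff_const.mul hΦ)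
  have hΨS : ContDiff ℝ (⊤ : ℕ∞) Ψ := by
    rw [hΨ]; exact (contDiff_const.mul hΦ).add (contDiff_const.mul (hΦ.mul hΦ))
  have hΔ : ContDiff ℝ (⊤ : ℕ∞) (fun y => ∑ j, pdR j (pdR j Φ) y) := ContDiff.sum fun j _ => hΦjk j j
  have hp : ContDiff ℝ (⊤ : ℕ∞) (fun y => 4 * m y + 2 * ∑ j, pdR j (pdR j Φ) y) :=
    (contDiff_const.mul hm).add (contDiff_const.mul hΔ)
  have hgS : ContDiff ℝ (⊤ : ℕ∞) (fun y => ∑ j, pdR j Φ y * pdR j Φ y) :=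
    ContDiff.sum fun j _ => (hΦj j).mul (hΦj j)
  have hμS : ContDiff ℝ (⊤ : ℕ∞) (fun y => (τ + s * Φ y) * (4 * m y + 2 * ∑ j, pdR j (pdR j Φ) y)
      + (2 * s) * ∑ j, pdR j Φ y * pdR j Φ y) := (hlamS.mul hp).add (contDiff_const.mul hgS)
  have hlamj : ∀ j x, pdR j (fun x => τ + s * Φ x) x = s * pdR j Φ x := by
    intro j x
    rw [pdR_add contDiff_const (contDiff_const.mul hΦ), pdR_const, pdR_const_mul hΦ]; ring
  have hΨj : ∀ j, pdR j Ψ = fun x => (τ + s * Φ x) * pdR j Φ x := by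
    intro j; ext x
    rw [hΨ, pdR_add (contDiff_const.mul hΦ) (contDiff_const.mul (hΦ.mul hΦ)),
      pdR_const_mul hΦ, pdR_const_mul (hΦ.mul hΦ), pdR_mul hΦ hΦ]
    ring
  have hΨjk : ∀ j k x, pdR j (pdR k Ψ) x =
      (τ + s * Φ x) * pdR j (pdR k Φ) x + s * (pdR j Φ x * pdR k Φ x) := by
    intro j k x
    rw [hΨj k, pdR_mul hlamS (hΦj k), hlamj]; ring
  have hμj : ∀ j x, pdR j (fun y => (τ + s * Φ y) * (4 * m y + 2 * ∑ j, pdR j (pdR j Φ) y)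
      + (2 * s) * ∑ j, pdR j Φ y * pdR j Φ y) x =
      (τ + s * Φ x) * pdR j (fun y => 4 * m y + 2 * ∑ j, pdR j (pdR j Φ) y) x
       + s * (pdR j Φ x * (4 * m x + 2 * ∑ j, pdR j (pdR j Φ) x)
      + 2 * pdR j (fun y => ∑ j, pdR j Φ y * pdR j Φ y) x) := by
    intro j x
    rw [pdR_add (hlamS.mul hp) (contDiff_const.mul hgS), pdR_mul hlamS hp,
      pdR_const_mul hgS, hlamj]; ring
  obtain ⟨D1, hD1, h1⟩ := ident1 hΨS hv hc hs
  obtain ⟨D2, hD2, h2⟩ := ident2 hμS hv hc hs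
  obtain ⟨D3, hD3, h3⟩ := ident2 (μ := fun _ => (1:ℝ)) contDiff_const hv hc hs
  refine ⟨_, (hD1.add ((hD2.smul (-1)).add (hD3.smul (-(M + 1 + c0 * s))))).smul (1 / 2), ?_⟩
  intro x hx
  set lam := τ + s * Φ x with hlam
  have hΦx := abs_le.1 (hΦM x hx)
  have hsM : 0 ≤ s * M := by positivity
  have hsΦ1 : s * Φ x ≤ s * M := by gcongr; exact hΦx.2
  have hsΦ2 : -(s * M) ≤ s * Φ x := by nlinarith
  have hl1 : τ / 2 ≤ lam := by linarith
  have hl2 : lam ≤ 2 * τ := by linarith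
  have hsτ : s ≤ τ := by nlinarith
  have hτ0 : 0 ≤ τ := by linarith
  have hll : lam ^ 2 ≤ 4 * τ ^ 2 := by nlinarith
  have hss : s ^ 2 ≤ τ ^ 2 := by nlinarith
  set g := ∑ j, pdR j Φ x * pdR j Φ x with hgdef
  set L0 := ∑ j, pdR j (pdR j Φ) x with hL0
  set E := ∑ j, pdR j v x * pdR j v x with hEdef
  set d := ∑ j, pdR j Φ x * pdR j v x with hd
  set B := ∑ j, b j x * pdR j v x with hBdef
  have eG : ∑ j, pdR j Ψ x * pdR j Ψ x = lam ^ 2 * g := by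
    rw [hgdef, Finset.mul_sum]
    exact Finset.sum_congr rfl fun j _ => by rw [hΨj]; ring
  have eP : ∑ j, pdR j Ψ x * pdR j v x = lam * d := by
    rw [hd, Finset.mul_sum]
    exact Finset.sum_congr rfl fun j _ => by rw [hΨj]; ring
  have eL : ∑ j, pdR j (pdR j Ψ) x = lam * L0 + s * g := by
    rw [hL0, hgdef, Finset.mul_sum, Finset.mul_sum, ← Finset.sum_add_distrib]
    exact Finset.sum_congr rfl fun j _ => hΨjk j j x
  have eH : ∀ X : Fin n → ℝ, ∑ j, ∑ k, pdR j (pdR k Ψ) x * X j * X k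
      = lam * (∑ j, ∑ k, pdR j (pdR k Φ) x * X j * X k) + s * (∑ j, pdR j Φ x * X j) ^ 2 := by
    intro X
    rw [pow_two, Finset.sum_mul_sum, Finset.mul_sum, Finset.mul_sum, ← Finset.sum_add_distrib]
    refine Finset.sum_congr rfl fun j _ => ?_
    rw [Finset.mul_sum, Finset.mul_sum, ← Finset.sum_add_distrib]
    refine Finset.sum_congr rfl fun k _ => ?_
    rw [hΨjk]; ring
  have eHv : ∑ j, ∑ k, pdR j (pdR k Ψ) x * pdR j v x * pdR k v x
      = lam * (- m x * E + d * B) + s * d ^ 2 := by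
    rw [eH (fun j => pdR j v x), hH x hx]
  have eHΨ : ∑ j, ∑ k, pdR j (pdR k Ψ) x * pdR j Ψ x * pdR k Ψ x
      = lam ^ 2 * (lam * (m x * g) + s * g ^ 2) := by
    rw [← hN x hx, hgdef, ← eH, Finset.mul_sum]
    refine Finset.sum_congr rfl fun j _ => ?_
    rw [Finset.mul_sum]
    refine Finset.sum_congr rfl fun k _ => ?_
    rw [hΨj, hΨj]; ring
  have hp' := hpM x hx
  have hg' := hgM x hx
  have hL' := hΔM x hx
  rw [← hgdef] at hg'
  rw [← hL0] at hp' hL'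
  have h1x := h1 x
  have h2x := h2 x
  have h3x := h3 x
  simp only [hμj] at h2x
  have hrj := hrjM x hx
  have hpj := hpjM x hx
  rw [← hL0] at hrj h2x
  rw [eG, eP, eL, eHv, eHΨ] at h1x
  rw [eG, eP, eL]
  simp only [← hlam, ← hgdef, ← hEdef] at h1x h2x h3x
  set W := ∑ j, pdR j (pdR j v) x with hW
  set F := ∑ j, (lam * pdR j (fun y => 4 * m y + 2 * ∑ j, pdR j (pdR j Φ) y) x
       + s * (pdR j Φ x * (4 * m x + 2 * L0)
      + 2 * pdR j (fun y => ∑ j, pdR j Φ y * pdR j Φ y) x)) * pdR j v x with hFdef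
  have hE0 : 0 ≤ E := Finset.sum_nonneg fun j _ => mul_self_nonneg _
  have hEsq : E = ∑ j, pdR j v x ^ 2 := Finset.sum_congr rfl fun j _ => by ring
  have hτs : 0 ≤ τ ^ 2 := sq_nonneg _
  have key := scalar_ineq c0 M s τ (W + lam ^ 2 * g * v x) (-2 * (lam * d)) (v x) E B F d g
    (lam * (4 * m x + 2 * L0) + 2 * s * g) lam (lam * L0 + s * g) (D1 x) (D2 x) (D3 x)
    hc0 hM hs1 hs2 hs3 hτ hl1 (hg x hx) hE0 ?_ ?_ ?_ ?_ ?_ ?_ ?_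
  · exact key
  · calc B ^ 2 ≤ (∑ j, b j x ^ 2) * ∑ j, pdR j v x ^ 2 := Finset.sum_mul_sq_le_sq_mul_sq _ _ _
      _ ≤ M * E := by rw [← hEsq]; exact mul_le_mul_of_nonneg_right (hbM x hx) hE0
  · have a1 : lam ^ 2 * (4 * m x + 2 * L0) ^ 2 ≤ 4 * τ ^ 2 * M := by gcongr
    have a2 : s ^ 2 * g ^ 2 ≤ τ ^ 2 * M := by gcongr
    linarith [sq_nonneg (lam * (4 * m x + 2 * L0) - 2 * s * g)]
  · have hF2 : F ^ 2 ≤ (10 * M * τ ^ 2) * E := by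
      calc F ^ 2 ≤ _ := Finset.sum_mul_sq_le_sq_mul_sq _ _ _
        _ ≤ (10 * M * τ ^ 2) * E := by
          rw [← hEsq]
          refine mul_le_mul_of_nonneg_right ?_ hE0
          calc _ ≤ ∑ i, (2 * lam ^ 2 * (pdR i (fun y => 4 * m y + 2 * ∑ j, pdR j (pdR j Φ) y) x) ^ 2
                + 2 * s ^ 2 * (pdR i Φ x * (4 * m x + 2 * L0)
      + 2 * pdR i (fun y => ∑ j, pdR j Φ y * pdR j Φ y) x) ^ 2) := by
                refine Finset.sum_le_sum fun i _ => ?_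
                generalize pdR i (fun y => 4 * m y + 2 * ∑ j, pdR j (pdR j Φ) y) x = α
                generalize pdR i Φ x * (4 * m x + 2 * L0)
                  + 2 * pdR i (fun y => ∑ j, pdR j Φ y * pdR j Φ y) x = β
                linarith [sq_nonneg (lam * α - s * β)]
            _ ≤ 2 * lam ^ 2 * M + 2 * s ^ 2 * M := by
                rw [Finset.sum_add_distrib, ← Finset.mul_sum, ← Finset.mul_sum]
                gcongr
            _ ≤ _ := by
                have a1 : lam ^ 2 * M ≤ 4 * τ ^ 2 * M := by gcongr
                have a2 : s ^ 2 * M ≤ τ ^ 2 * M := by gcongr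
                linarith
    have hK : 0 ≤ 5 * M * τ ^ 2 * v x ^ 2 + E := by positivity
    refine abs_le_of_sq_le_sq ?_ hK
    have : (v x * F) ^ 2 ≤ v x ^ 2 * ((10 * M * τ ^ 2) * E) := by
      rw [mul_pow]; gcongr
    linarith [sq_nonneg (5 * M * τ ^ 2 * v x ^ 2), sq_nonneg E]
  · have a1 : lam ^ 2 * L0 ^ 2 ≤ 4 * τ ^ 2 * M := by gcongr
    have a2 : s ^ 2 * g ^ 2 ≤ τ ^ 2 * M := by gcongr
    linarith [sq_nonneg (lam * L0 - s * g)]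
  · rw [h1x]; ring
  · rw [h2x]; ring
  · rw [h3x]; simp only [pdR_const]; simp

end core

section conj
variable {n : ℕ}

lemma pdR_exp {Ψ : En n → ℝ} (hΨ : ContDiff ℝ (⊤ : ℕ∞) Ψ) (j : Fin n) (x : En n) :
    pdR j (fun y => Real.exp (Ψ y)) x = Real.exp (Ψ x) * pdR j Ψ x := by
  unfold pdR
  rw [fderiv_exp (smooth_diff hΨ x)]
  simp

lemma conj1 {Ψ u : En n → ℝ} (hΨ : ContDiff ℝ (⊤ : ℕ∞) Ψ) (hu : ContDiff ℝ (⊤ : ℕ∞) u)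
    (j : Fin n) : pdR j (fun y => Real.exp (Ψ y) * u y) =
      fun x => Real.exp (Ψ x) * (pdR j u x + pdR j Ψ x * u x) := by
  ext x
  rw [pdR_mul hΨ.exp hu, pdR_exp hΨ]; ring

lemma conj2 {Ψ u : En n → ℝ} (hΨ : ContDiff ℝ (⊤ : ℕ∞) Ψ) (hu : ContDiff ℝ (⊤ : ℕ∞) u) (x : En n) :
    (∑ j, pdR j (pdR j (fun y => Real.exp (Ψ y) * u y)) x)
      + (∑ j, pdR j Ψ x * pdR j Ψ x) * (Real.exp (Ψ x) * u x)
        + (-2 * ∑ j, pdR j Ψ x * pdR j (fun y => Real.exp (Ψ y) * u y) x)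
        - (∑ j, pdR j (pdR j Ψ) x) * (Real.exp (Ψ x) * u x)
    = Real.exp (Ψ x) * ∑ j, pdR j (pdR j u) x := by
  have hj : ∀ j, ContDiff ℝ (⊤ : ℕ∞) (fun x => pdR j u x + pdR j Ψ x * u x) := fun j =>
    (pdR_smooth hu j).add ((pdR_smooth hΨ j).mul hu)
  simp only [conj1 hΨ hu, pdR_mul hΨ.exp (hj _), pdR_exp hΨ,
    pdR_add (pdR_smooth hu _) ((pdR_smooth hΨ _).mul hu), pdR_mul (pdR_smooth hΨ _) hu]
  simp only [Finset.mul_sum, Finset.sum_mul]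
  simp only [← Finset.sum_add_distrib, ← Finset.sum_sub_distrib]
  exact Finset.sum_congr rfl fun j _ => by ring

/-- bounds on a compact set for continuous functions -/
lemma bdd_on {Ω : Set (En n)} (hb : Bornology.IsBounded Ω) {f : En n → ℝ} (hf : Continuous f) :
    ∃ M, ∀ x ∈ Ω, f x ≤ M := by
  obtain ⟨M, hM⟩ := (hb.isCompact_closure.bddAbove_image hf.continuousOn)
  exact ⟨M, fun x hx => hM ⟨x, subset_closure hx, rfl⟩⟩

lemma ext_smooth {Ω U : Set (En n)} (hU : IsOpen U) (hΩU : closure Ω ⊆ U) {f : En n → ℝ}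
    (hf : ContDiffOn ℝ (⊤ : ℕ∞) f U) :
    ∃ F : En n → ℝ, ContDiff ℝ (⊤ : ℕ∞) F ∧ ∃ W, IsOpen W ∧ closure Ω ⊆ W ∧ W ⊆ U ∧
      ∀ x ∈ W, F x = f x := by
  have hd : Disjoint Uᶜ (closure Ω) := by
    rw [Set.disjoint_left]; exact fun x hx h => hx (hΩU h)
  obtain ⟨χ, h0, h1, -⟩ := exists_contMDiffMap_zero_one_nhds_of_isClosed
    (modelWithCornersSelf ℝ (En n)) (n := ⊤) hU.isClosed_compl isClosed_closure hd
  have hχ : ContDiff ℝ (⊤ : ℕ∞) (χ : En n → ℝ) := χ.contMDiff.contDiff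
  obtain ⟨W, hWo, hWc, hW⟩ := eventually_nhdsSet_iff_exists.1 h1
  refine ⟨fun x => χ x * f x, ?_, W ∩ U, hWo.inter hU, Set.subset_inter hWc hΩU,
    Set.inter_subset_right, fun x hx => by simp [hW x hx.1]⟩
  rw [contDiff_iff_contDiffAt]
  intro x
  by_cases hx : x ∈ U
  · exact hχ.contDiffAt.mul (hf.contDiffAt (hU.mem_nhds hx))
  · have : ∀ᶠ y in nhds x, χ y = 0 := by
      have := Filter.eventually_iff.1 h0
      exact (Filter.Eventually.filter_mono (nhds_le_nhdsSet hx) h0)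
    have h' : (fun x => χ x * f x) =ᶠ[nhds x] fun _ => 0 := by
      filter_upwards [this] with y hy
      simp [hy]
    exact contDiffAt_const.congr_of_eventuallyEq h'

set_option maxHeartbeats 1000000 in
lemma core_u {Ω W : Set (En n)} (hb : Bornology.IsBounded Ω) (hW : IsOpen W) (hΩW : closure Ω ⊆ W)
    {Φ : En n → ℝ} (hΦ : ContDiff ℝ (⊤ : ℕ∞) Φ)
    (hg0 : ∀ x ∈ W, 0 < ∑ j, pdR j Φ x * pdR j Φ x)
    (hH : ∀ x ∈ W, ∀ X : Fin n → ℝ,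
      (∑ j, pdR j Φ x * pdR j Φ x) * ∑ j, ∑ k, pdR j (pdR k Φ) x * X j * X k
      = - (∑ j, ∑ k, pdR j (pdR k Φ) x * pdR j Φ x * pdR k Φ x) * (∑ j, X j * X j)
        + (∑ j, pdR j Φ x * X j) * (∑ j, (2 * ∑ k, pdR j (pdR k Φ) x * pdR k Φ x) * X j)) :
    ∃ c > 0, ∃ M ≥ 1, ∃ s₀ ≥ 1, (∀ x ∈ Ω, |Φ x| ≤ M) ∧ ∀ s ≥ s₀, ∀ τ ≥ 32 * s * M,
      ∀ Ψ : En n → ℝ, Ψ = (fun x => τ * Φ x + (s / 2) * (Φ x * Φ x)) →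
      ∀ u : En n → ℝ, ContDiff ℝ (⊤ : ℕ∞) u → HasCompactSupport u → tsupport u ⊆ Ω →
      ∃ D, IsDiv Ω D ∧ ∀ x ∈ Ω,
        s * c * (Real.exp (2 * Ψ x) * (τ ^ 2 * u x ^ 2 + ∑ j, pdR j u x ^ 2)) + D x
        ≤ Real.exp (2 * Ψ x) * (∑ j, pdR j (pdR j u) x) ^ 2 := by
  have hΦj := fun j => pdR_smooth hΦ j
  have hΦjk := fun j k => pdR_smooth (hΦj k) j
  have hΔ : ContDiff ℝ (⊤ : ℕ∞) (fun y => ∑ j, pdR j (pdR j Φ) y) := ContDiff.sum fun j _ => hΦjk j j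
  have hgS : ContDiff ℝ (⊤ : ℕ∞) (fun y => ∑ j, pdR j Φ y * pdR j Φ y) :=
    ContDiff.sum fun j _ => (hΦj j).mul (hΦj j)
  have hNS : ContDiff ℝ (⊤ : ℕ∞) (fun x => ∑ j, ∑ k, pdR j (pdR k Φ) x * pdR j Φ x * pdR k Φ x) :=
    ContDiff.sum fun j _ => ContDiff.sum fun k _ => ((hΦjk j k).mul (hΦj j)).mul (hΦj k)
  have hbS : ∀ j, ContDiff ℝ (⊤ : ℕ∞) (fun x => 2 * ∑ k, pdR j (pdR k Φ) x * pdR k Φ x) := fun j =>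
    contDiff_const.mul (ContDiff.sum fun k _ => (hΦjk j k).mul (hΦj k))
  obtain ⟨m, hm, W1, hW1o, hW1c, -, hm1⟩ := ext_smooth hW hΩW
    (hNS.contDiffOn.div hgS.contDiffOn fun x hx => (hg0 x hx).ne')
  choose b hbb W2 _ hW2c _ hb1 using fun j => ext_smooth hW hΩW
    ((hbS j).contDiffOn.div hgS.contDiffOn fun x hx => (hg0 x hx).ne')
  have hp : ContDiff ℝ (⊤ : ℕ∞) (fun y => 4 * m y + 2 * ∑ j, pdR j (pdR j Φ) y) :=
    (contDiff_const.mul hm).add (contDiff_const.mul hΔ)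
  have hHH : ∀ x ∈ Ω, ∀ X : Fin n → ℝ, ∑ j, ∑ k, pdR j (pdR k Φ) x * X j * X k
      = - m x * (∑ j, X j * X j) + (∑ j, pdR j Φ x * X j) * (∑ j, b j x * X j) := by
    intro x hx X
    have hxW := hΩW (subset_closure hx)
    have hgx := hg0 x hxW
    have e1 := hm1 x (hW1c (subset_closure hx))
    have e2 : ∀ j, b j x = _ := fun j => hb1 j x (hW2c j (subset_closure hx))
    have h := hH x hxW X
    simp only [Pi.div_apply] at e1 e2
    simp only [e2]
    rw [e1]
    have e3 : ∑ j, (2 * ∑ k, pdR j (pdR k Φ) x * pdR k Φ x) / (∑ j, pdR j Φ x * pdR j Φ x) * X j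
      = (∑ j, (2 * ∑ k, pdR j (pdR k Φ) x * pdR k Φ x) * X j) / (∑ j, pdR j Φ x * pdR j Φ x) := by
      rw [Finset.sum_div]
      exact Finset.sum_congr rfl fun j _ => by ring
    rw [e3, ← mul_right_inj' hgx.ne', h]
    have hgn := hgx.ne'
    generalize (∑ j, pdR j Φ x * pdR j Φ x) = G at hgn ⊢
    field_simp
  have hNN : ∀ x ∈ Ω, ∑ j, ∑ k, pdR j (pdR k Φ) x * pdR j Φ x * pdR k Φ x
      = m x * ∑ j, pdR j Φ x * pdR j Φ x := by
    intro x hx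
    have hgx := hg0 x (hΩW (subset_closure hx))
    rw [hm1 x (hW1c (subset_closure hx)), Pi.div_apply, div_mul_cancel₀ _ hgx.ne']
  -- lower bound
  obtain ⟨c0, hc0, hc0g⟩ : ∃ c0 > 0, ∀ x ∈ Ω, c0 ≤ ∑ j, pdR j Φ x * pdR j Φ x := by
    rcases Ω.eq_empty_or_nonempty with he | hne
    · exact ⟨1, one_pos, by simp [he]⟩
    · obtain ⟨x0, hx0, hmin⟩ := hb.isCompact_closure.exists_isMinOn hne.closure hgS.continuous.continuousOn
      exact ⟨_, hg0 x0 (hΩW hx0), fun x hx => hmin (subset_closure hx)⟩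
  obtain ⟨M1, hM1⟩ := bdd_on hb (hgS.pow 2).continuous
  obtain ⟨M2, hM2⟩ := bdd_on hb (hΦ.continuous.abs)
  obtain ⟨M3, hM3⟩ := bdd_on hb (ContDiff.sum (s := Finset.univ) fun j _ => (hbb j).pow 2).continuous
  obtain ⟨M4, hM4⟩ := bdd_on hb (hΔ.pow 2).continuous
  obtain ⟨M5, hM5⟩ := bdd_on hb (hp.pow 2).continuous
  obtain ⟨M6, hM6⟩ := bdd_on hb (ContDiff.sum (s := Finset.univ) fun j _ => (pdR_smooth hp j).pow 2).continuous
  obtain ⟨M7, hM7⟩ := bdd_on hb (ContDiff.sum (s := Finset.univ) fun i _ =>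
    (((hΦj i).mul hp).add (contDiff_const (c := (2:ℝ)).mul (pdR_smooth hgS i))).pow 2).continuous
  obtain ⟨M, hM, g1, g2, g3, g4, g5, g6, g7⟩ : ∃ M ≥ (1:ℝ), M1 ≤ M ∧ M2 ≤ M ∧ M3 ≤ M ∧ M4 ≤ M ∧ M5 ≤ M
      ∧ M6 ≤ M ∧ M7 ≤ M := by
    refine ⟨1 + |M1| + |M2| + |M3| + |M4| + |M5| + |M6| + |M7|, ?_, ?_, ?_, ?_, ?_, ?_, ?_, ?_⟩
    · have := abs_nonneg M1
      have := abs_nonneg M2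
      have := abs_nonneg M3
      have := abs_nonneg M4
      have := abs_nonneg M5
      have := abs_nonneg M6
      have := abs_nonneg M7
      linarith
    all_goals
      linarith [abs_nonneg M1, abs_nonneg M2, abs_nonneg M3, abs_nonneg M4, abs_nonneg M5,
       abs_nonneg M6, abs_nonneg M7, le_abs_self M1, le_abs_self M2, le_abs_self M3, le_abs_self M4,
       le_abs_self M5, le_abs_self M6, le_abs_self M7]
  have hcm : 0 < min (c0 ^ 2 / 16) (c0 / 2) := lt_min (by positivity) (by positivity)
  refine ⟨min (c0 ^ 2 / 16) (c0 / 2) / (2 + 8 * M), div_pos hcm (by linarith), M, hM,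
    max 1 (max ((M + 1) / c0) (168 * M / c0 ^ 2)), le_max_left _ _,
    fun x hx => (hM2 x hx).trans g2, ?_⟩
  intro s hs τ hτ Ψ hΨ u hu huc hus
  have hs1 : 1 ≤ s := (le_max_left _ _).trans hs
  have hs2 : M + 1 ≤ c0 * s := by
    have := ((le_max_left _ _).trans (le_max_right _ _)).trans hs
    rwa [div_le_iff₀' hc0] at this
  have hs3 : 168 * M ≤ c0 ^ 2 * s := by
    have := ((le_max_right _ _).trans (le_max_right _ _)).trans hs
    rwa [div_le_iff₀' (by positivity)] at this
  have hΨS : ContDiff ℝ (⊤ : ℕ∞) Ψ := by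
    rw [hΨ]; exact (contDiff_const.mul hΦ).add (contDiff_const.mul (hΦ.mul hΦ))
  have hsub : tsupport (fun y => Real.exp (Ψ y) * u y) ⊆ tsupport u := by
    refine closure_mono fun x hx => ?_
    intro h
    exact hx (by simp [h])
  obtain ⟨D, hD, hineq⟩ := core_real (Ω := Ω) (Φ := Φ) (m := m) (b := b) (c0 := c0) (M := M) hΦ hm hc0 hM
    hHH hNN hc0g (fun x hx => (hM1 x hx).trans g1) (fun x hx => (hM2 x hx).trans g2)
    (fun x hx => (hM3 x hx).trans g3) (fun x hx => (hM4 x hx).trans g4)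
    (fun x hx => (hM5 x hx).trans g5) (fun x hx => (hM6 x hx).trans g6)
    (fun x hx => (hM7 x hx).trans g7) s τ hs1 hs2 hs3 hτ (fun y => Real.exp (Ψ y) * u y) Ψ hΨ
    (hΨS.exp.mul hu) (huc.of_isClosed_subset (isClosed_tsupport _) hsub) (hsub.trans hus)
  · refine ⟨D, hD, fun x hx => ?_⟩
    have h := hineq x hx
    rw [conj2 hΨS hu] at h
    have e2 : Real.exp (2 * Ψ x) = Real.exp (Ψ x) ^ 2 := by
      rw [← Real.exp_nat_mul]; norm_num
    rw [mul_pow (Real.exp (Ψ x)) (∑ j, pdR j (pdR j u) x), ← e2] at h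
    refine le_trans ?_ h
    suffices K : Real.exp (2 * Ψ x) * (τ ^ 2 * u x ^ 2 + ∑ j, pdR j u x ^ 2) ≤
        (τ ^ 2 * (Real.exp (Ψ x) * u x) ^ 2 + ∑ j, pdR j (fun y => Real.exp (Ψ y) * u y) x
          * pdR j (fun y => Real.exp (Ψ y) * u y) x) * (2 + 8 * M) by
      have hpos : 0 < 2 + 8 * M := by linarith
      have hnn : 0 ≤ s * (min (c0 ^ 2 / 16) (c0 / 2) / (2 + 8 * M)) :=
        mul_nonneg (by linarith) (div_pos hcm hpos).le
      have := mul_le_mul_of_nonneg_left K hnn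
      refine add_le_add (this.trans (le_of_eq ?_)) le_rfl
      field_simp
    -- goal: exp(2Ψ) (τ² u² + Σ u_j²) ≤ (τ² v² + Σ v_j²)(2+8M)
    have hΦx := abs_le.1 ((hM2 x hx).trans g2)
    have hsM : 0 ≤ s * M := by positivity
    have hsΦ1 : s * Φ x ≤ s * M := by gcongr; exact hΦx.2
    have hsΦ2 : -(s * M) ≤ s * Φ x := by nlinarith
    have hll : (τ + s * Φ x) ^ 2 ≤ 4 * τ ^ 2 := by nlinarith
    have hgM : ∑ j, pdR j Φ x * pdR j Φ x ≤ M := by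
      have := (hM1 x hx).trans g1
      have h0 := (hc0g x hx)
      nlinarith
    have hΨj : ∀ j, pdR j Ψ x = (τ + s * Φ x) * pdR j Φ x := by
      intro j
      rw [hΨ, pdR_add (contDiff_const.mul hΦ) (contDiff_const.mul (hΦ.mul hΦ)),
        pdR_const_mul hΦ, pdR_const_mul (hΦ.mul hΦ), pdR_mul hΦ hΦ]
      ring
    set v := Real.exp (Ψ x) * u x with hv
    have k1 : Real.exp (Ψ x) ^ 2 * ∑ j, pdR j u x ^ 2 ≤
        2 * (∑ j, pdR j (fun y => Real.exp (Ψ y) * u y) x * pdR j (fun y => Real.exp (Ψ y) * u y) x)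
        + 2 * (τ + s * Φ x) ^ 2 * v ^ 2 * ∑ j, pdR j Φ x * pdR j Φ x := by
      rw [Finset.mul_sum, Finset.mul_sum, Finset.mul_sum, ← Finset.sum_add_distrib]
      refine Finset.sum_le_sum fun j _ => ?_
      rw [conj1 hΨS hu]
      simp only [hΨj, hv]
      generalize pdR j u x = α
      generalize pdR j Φ x = β
      generalize τ + s * Φ x = l
      nlinarith [sq_nonneg (Real.exp (Ψ x) * (α + l * β * u x) + l * β * (Real.exp (Ψ x) * u x))]
    have k2 : (τ + s * Φ x) ^ 2 * v ^ 2 * ∑ j, pdR j Φ x * pdR j Φ x ≤ (4 * τ ^ 2) * v ^ 2 * M := by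
      have : 0 ≤ ∑ j, pdR j Φ x * pdR j Φ x := hc0.le.trans (hc0g x hx)
      gcongr
    have k3 : 0 ≤ ∑ j, pdR j (fun y => Real.exp (Ψ y) * u y) x * pdR j (fun y => Real.exp (Ψ y) * u y) x :=
      Finset.sum_nonneg fun j _ => mul_self_nonneg _
    rw [e2]
    have k4 : Real.exp (Ψ x) ^ 2 * u x ^ 2 = v ^ 2 := by rw [hv]; ring
    generalize (∑ j, pdR j (fun y => Real.exp (Ψ y) * u y) x * pdR j (fun y => Real.exp (Ψ y) * u y) x) = E at *
    have k5 : 0 ≤ M * E := by positivity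
    have k6 : 0 ≤ τ ^ 2 * v ^ 2 := by positivity
    have k7 : Real.exp (Ψ x) ^ 2 * (τ ^ 2 * u x ^ 2 + ∑ j, pdR j u x ^ 2) =
      τ ^ 2 * v ^ 2 + Real.exp (Ψ x) ^ 2 * ∑ j, pdR j u x ^ 2 := by rw [← k4]; ring
    rw [k7]
    linarith

end conj

section fin
variable {n : ℕ}

lemma lcw_alg {E : Type*} [NormedAddCommGroup E] [InnerProductSpace ℝ E] (B : E →L[ℝ] E →L[ℝ] ℝ)
    (hB : ∀ v w, B v w = B w v) (N : E) (hN : N ≠ 0)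
    (h : ∀ ξ : E, ‖ξ‖ ^ 2 = ‖N‖ ^ 2 → ⟪N, ξ⟫ = 0 → B N N + B ξ ξ = 0) (X : E) :
    ‖N‖ ^ 2 * B X X = - B N N * ‖X‖ ^ 2 + ⟪N, X⟫ * (2 * B X N) := by
  have hg : 0 < ‖N‖ ^ 2 := by positivity
  have hperp : ∀ Y : E, ⟪N, Y⟫ = 0 → ‖N‖ ^ 2 * B Y Y = - B N N * ‖Y‖ ^ 2 := by
    intro Y hY
    by_cases hY0 : Y = 0
    · simp [hY0]
    · have hYn : ‖Y‖ ≠ 0 := norm_ne_zero_iff.2 hY0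
      have := h ((‖N‖ / ‖Y‖) • Y) (by
        rw [norm_smul, Real.norm_of_nonneg (by positivity)]; field_simp) (by
        rw [inner_smul_right, hY, mul_zero])
      simp only [map_smul, _root_.smul_apply, smul_eq_mul] at this
      field_simp at this
      linarith
  have hNN : ⟪N, N⟫ = ‖N‖ ^ 2 := real_inner_self_eq_norm_sq N
  have hY := hperp (‖N‖ ^ 2 • X - ⟪N, X⟫ • N) (by
    rw [inner_sub_right, inner_smul_right, inner_smul_right, hNN]; ring)
  have hnorm : ‖‖N‖ ^ 2 • X - ⟪N, X⟫ • N‖ ^ 2 = (‖N‖ ^ 2) ^ 2 * ‖X‖ ^ 2 - ‖N‖ ^ 2 * ⟪N, X⟫ ^ 2 := by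
    rw [norm_sub_sq_real, norm_smul, norm_smul, inner_smul_left, inner_smul_right, mul_pow, mul_pow,
      real_inner_comm]
    simp
    ring
  rw [hnorm] at hY
  simp only [map_sub, map_smul, _root_.sub_apply, _root_.smul_apply,
    smul_eq_mul] at hY
  rw [hB N X] at hY
  have h2 : (‖N‖ ^ 2) ^ 2 * (‖N‖ ^ 2 * B X X) = 
      (‖N‖ ^ 2) ^ 2 * (- B N N * ‖X‖ ^ 2 + ⟪N, X⟫ * (2 * B X N)) := by
    linarith
  exact mul_left_cancel₀ (by positivity) h2

lemma sum_single (a : En n) : a = ∑ j, a j • EuclideanSpace.single j (1:ℝ) := by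
  have := (EuclideanSpace.basisFun (Fin n) ℝ).sum_repr a
  simpa using this.symm

lemma grad_coord (Φ : En n → ℝ) (x : En n) (j : Fin n) : gradient Φ x j = pdR j Φ x := by
  unfold gradient pdR
  rw [← InnerProductSpace.toDual_symm_apply (𝕜 := ℝ), EuclideanSpace.inner_single_right]
  simp

lemma snd_fderiv {Φ : En n → ℝ} (hΦ : ContDiff ℝ (⊤ : ℕ∞) Φ) (x a b : En n) :
    fderiv ℝ (fun y => fderiv ℝ Φ y a) x b = fderiv ℝ (fderiv ℝ Φ) x b a := by
  have hd : DifferentiableAt ℝ (fderiv ℝ Φ) x :=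
    ((hΦ.fderiv_right (m := (⊤ : ℕ∞)) (by simp)).differentiable (by simp)) x
  rw [fderiv_clm_apply hd (differentiableAt_const _)]
  simp

lemma lcw_coord {Φ : En n → ℝ} (hΦ : ContDiff ℝ (⊤ : ℕ∞) Φ) (x : En n)
    (hgrad : gradient Φ x ≠ 0)
    (hlcw : ∀ ξ : En n, ‖ξ‖ ^ 2 = ‖gradient Φ x‖ ^ 2 → ⟪gradient Φ x, ξ⟫ = 0 →
      hess Φ x (gradient Φ x) (gradient Φ x) + hess Φ x ξ ξ = 0) :
    0 < ∑ j, pdR j Φ x * pdR j Φ x ∧ ∀ X : Fin n → ℝ,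
      (∑ j, pdR j Φ x * pdR j Φ x) * ∑ j, ∑ k, pdR j (pdR k Φ) x * X j * X k
      = - (∑ j, ∑ k, pdR j (pdR k Φ) x * pdR j Φ x * pdR k Φ x) * (∑ j, X j * X j)
        + (∑ j, pdR j Φ x * X j) * (∑ j, (2 * ∑ k, pdR j (pdR k Φ) x * pdR k Φ x) * X j) := by
  have hsym : IsSymmSndFDerivAt ℝ Φ x := by
    apply (hΦ.contDiffAt (x := x)).isSymmSndFDerivAt
    simp only [minSmoothness_of_isRCLikeNormedField]
    exact WithTop.coe_le_coe.2 (le_top : (2:ℕ∞) ≤ ⊤)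
  have hN2 : ‖gradient Φ x‖ ^ 2 = ∑ j, pdR j Φ x * pdR j Φ x := by
    rw [EuclideanSpace.norm_sq_eq]
    exact Finset.sum_congr rfl fun j _ => by rw [grad_coord, Real.norm_eq_abs, sq_abs, sq]
  have hBjk : ∀ j k, pdR j (pdR k Φ) x =
      fderiv ℝ (fderiv ℝ Φ) x (EuclideanSpace.single j 1) (EuclideanSpace.single k 1) := by
    intro j k
    unfold pdR
    rw [snd_fderiv hΦ]
  have hBsum : ∀ a b : En n, ∑ j, ∑ k, pdR j (pdR k Φ) x * a j * b k = fderiv ℝ (fderiv ℝ Φ) x a b := by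
    intro a b
    conv_rhs => rw [sum_single a, sum_single b]
    simp only [map_sum, map_smul, _root_.sum_apply, _root_.smul_apply,
      smul_eq_mul]
    rw [Finset.sum_comm]
    refine Finset.sum_congr rfl fun j _ => ?_
    rw [Finset.mul_sum]
    refine Finset.sum_congr rfl fun k _ => ?_
    rw [hBjk]; ring
  refine ⟨by rw [← hN2]; positivity, fun X => ?_⟩
  have key := lcw_alg (fderiv ℝ (fderiv ℝ Φ) x) (fun v w => hsym v w) (gradient Φ x) hgrad
    (by simpa only [hess, snd_fderiv hΦ] using hlcw) (WithLp.toLp 2 X)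
  rw [← hBsum, ← hBsum, ← hBsum, hN2] at key
  simp only [grad_coord] at key
  have hX2 : ‖(WithLp.toLp 2 X : En n)‖ ^ 2 = ∑ j, X j * X j := by
    rw [EuclideanSpace.norm_sq_eq]
    exact Finset.sum_congr rfl fun j _ => by simp [sq]
  have hin : ⟪gradient Φ x, (WithLp.toLp 2 X : En n)⟫ = ∑ j, pdR j Φ x * X j := by
    rw [PiLp.inner_apply]
    refine Finset.sum_congr rfl fun j _ => ?_
    rw [grad_coord]; simp [mul_comm]
  rw [hX2, hin] at key
  rw [key]
  congr 2
  rw [Finset.mul_sum]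
  refine Finset.sum_congr rfl fun j _ => ?_
  rw [Finset.mul_sum, Finset.mul_sum, Finset.sum_mul]
  refine Finset.sum_congr rfl fun k _ => ?_
  ring

lemma pd_smooth {f : En n → ℂ} (hf : ContDiff ℝ (⊤ : ℕ∞) f) (j : Fin n) :
    ContDiff ℝ (⊤ : ℕ∞) (pd j f) := by
  unfold pd
  exact (hf.fderiv_right (m := (⊤ : ℕ∞)) (by simp)).clm_apply contDiff_const

lemma pd_re {f : En n → ℂ} (hf : ContDiff ℝ (⊤ : ℕ∞) f) (j : Fin n) :
    (fun x => (pd j f x).re) = pdR j (fun x => (f x).re) := by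
  ext x
  have h := (Complex.reCLM.hasFDerivAt.comp x (hf.differentiable (by simp) x).hasFDerivAt)
  have h2 : fderiv ℝ (fun x => (f x).re) x = _ := h.fderiv
  unfold pdR pd
  rw [h2]; simp

lemma pd_im {f : En n → ℂ} (hf : ContDiff ℝ (⊤ : ℕ∞) f) (j : Fin n) :
    (fun x => (pd j f x).im) = pdR j (fun x => (f x).im) := by
  ext x
  have h := (Complex.imCLM.hasFDerivAt.comp x (hf.differentiable (by simp) x).hasFDerivAt)
  have h2 : fderiv ℝ (fun x => (f x).im) x = _ := h.fderiv
  unfold pdR pd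
  rw [h2]; simp

lemma nsq (z : ℂ) : ‖z‖ ^ 2 = z.re ^ 2 + z.im ^ 2 := by
  rw [Complex.sq_norm, Complex.normSq_apply]; ring

lemma complex_split {u : En n → ℂ} (hu : ContDiff ℝ (⊤ : ℕ∞) u) (x : En n) :
    (∑ j, ‖pd j u x‖ ^ 2 = ∑ j, pdR j (fun y => (u y).re) x ^ 2 + ∑ j, pdR j (fun y => (u y).im) x ^ 2)
    ∧ ‖∑ j, pd j (pd j u) x‖ ^ 2 = (∑ j, pdR j (pdR j (fun y => (u y).re)) x) ^ 2
      + (∑ j, pdR j (pdR j (fun y => (u y).im)) x) ^ 2 := by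
  constructor
  · rw [← Finset.sum_add_distrib]
    refine Finset.sum_congr rfl fun j _ => ?_
    rw [nsq, ← pd_re hu, ← pd_im hu]
  · rw [nsq, Complex.re_sum, Complex.im_sum]
    congr 2
    · refine Finset.sum_congr rfl fun j _ => ?_
      rw [← pd_re hu, ← pd_re (pd_smooth hu j)]
    · refine Finset.sum_congr rfl fun j _ => ?_
      rw [← pd_im hu, ← pd_im (pd_smooth hu j)]

lemma lower_order {MA MB Mq : ℝ} (A : Fin n → ℝ) (dA : ℝ) (q u : ℂ) (p : Fin n → ℂ)
    (hA : ∑ j, A j ^ 2 ≤ MA) (hB : |dA| ≤ MB) (hq : ‖q‖ ≤ Mq) :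
    ‖- (2 * I * (∑ j, (A j : ℂ) * p j)) - I * (dA : ℂ) * u
      + (((∑ j, (A j) ^ 2 : ℝ) : ℂ) + q) * u‖ ^ 2
    ≤ (8 * MA + 2 * (MA + MB + Mq) ^ 2) * (‖u‖ ^ 2 + ∑ j, ‖p j‖ ^ 2) := by
  have hA0 : 0 ≤ ∑ j, A j ^ 2 := Finset.sum_nonneg fun j _ => sq_nonneg _
  have h1 : ‖∑ j, (A j : ℂ) * p j‖ ^ 2 ≤ MA * ∑ j, ‖p j‖ ^ 2 := by
    calc ‖∑ j, (A j : ℂ) * p j‖ ^ 2 ≤ (∑ j, |A j| * ‖p j‖) ^ 2 := by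
          gcongr
          refine (norm_sum_le _ _).trans (le_of_eq ?_)
          exact Finset.sum_congr rfl fun j _ => by rw [norm_mul, Complex.norm_real, Real.norm_eq_abs]
      _ ≤ (∑ j, |A j| ^ 2) * ∑ j, ‖p j‖ ^ 2 := Finset.sum_mul_sq_le_sq_mul_sq _ _ _
      _ ≤ _ := by
          simp only [sq_abs]
          exact mul_le_mul_of_nonneg_right hA (Finset.sum_nonneg fun j _ => sq_nonneg _)
  have h2 : ‖- (2 * I * (∑ j, (A j : ℂ) * p j)) - I * (dA : ℂ) * u
      + (((∑ j, (A j) ^ 2 : ℝ) : ℂ) + q) * u‖ ≤ 2 * ‖∑ j, (A j : ℂ) * p j‖ + (MA + MB + Mq) * ‖u‖ := by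
    calc _ ≤ ‖2 * I * (∑ j, (A j : ℂ) * p j)‖ + ‖I * (dA : ℂ) * u‖
          + ‖(((∑ j, (A j) ^ 2 : ℝ) : ℂ) + q) * u‖ := by
          refine (norm_add_le _ _).trans ?_
          gcongr
          refine (norm_sub_le _ _).trans ?_
          rw [norm_neg]
      _ ≤ 2 * ‖∑ j, (A j : ℂ) * p j‖ + MB * ‖u‖ + (MA + Mq) * ‖u‖ := by
          gcongr
          · simp
          · rw [norm_mul, norm_mul, Complex.norm_I, one_mul, Complex.norm_real, Real.norm_eq_abs]
            gcongr
          · rw [norm_mul]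
            gcongr
            refine (norm_add_le _ _).trans ?_
            gcongr
            rwa [Complex.norm_real, Real.norm_of_nonneg hA0]
      _ = _ := by ring
  have h3 : ∀ α β γ : ℝ, 0 ≤ γ → γ ≤ 2 * α + β → γ ^ 2 ≤ 8 * α ^ 2 + 2 * β ^ 2 := by
    intro α β γ h0 h
    have : γ ^ 2 ≤ (2 * α + β) ^ 2 := pow_le_pow_left₀ h0 h 2
    linarith [sq_nonneg (2 * α - β)]
  refine (h3 _ _ _ (norm_nonneg _) h2).trans ?_
  have hp0 : 0 ≤ ∑ j, ‖p j‖ ^ 2 := Finset.sum_nonneg fun j _ => sq_nonneg _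
  have e1 : 0 ≤ MA * ‖u‖ ^ 2 := mul_nonneg (hA0.trans hA) (sq_nonneg _)
  have e2 : 0 ≤ (MA + MB + Mq) ^ 2 * ∑ j, ‖p j‖ ^ 2 := mul_nonneg (sq_nonneg _) hp0
  rw [mul_pow]
  linarith

end fin

section main
variable {n : ℕ}

lemma Lmag_bound {Ω U : Set (En n)} (hb : Bornology.IsBounded Ω) (hU : IsOpen U)
    (hΩU : closure Ω ⊆ U) (A : En n → En n) (hA : ContDiffOn ℝ 1 A U)
    (q : En n → ℂ) (hq : ∃ M, ∀ x ∈ Ω, ‖q x‖ ≤ M) :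
    ∃ K ≥ 0, ∀ u : En n → ℂ, ∀ x ∈ Ω,
      ‖Lmag A q u x + ∑ j, pd j (pd j u) x‖ ^ 2 ≤ K * (‖u x‖ ^ 2 + ∑ j, ‖pd j u x‖ ^ 2) := by
  obtain ⟨Mq, hMq⟩ := hq
  have hAj : ∀ j, ContDiffOn ℝ 1 (fun y => A y j) U := fun j =>
    (contDiffOn_euclidean (𝕜 := ℝ)).1 hA j
  have hdA : ∀ j, ContinuousOn (pdR j (fun y => A y j)) U := fun j =>
    ((hAj j).continuousOn_fderiv_of_isOpen hU le_rfl).clm_apply continuousOn_const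
  have hcpt := hb.isCompact_closure
  obtain ⟨MA, hMA⟩ := hcpt.bddAbove_image
    ((continuousOn_finsetSum Finset.univ fun j _ => ((hAj j).continuousOn.pow 2)).mono hΩU)
  obtain ⟨MB, hMB⟩ := hcpt.bddAbove_image
    (((continuousOn_finsetSum Finset.univ fun j _ => hdA j).abs).mono hΩU)
  refine ⟨8 * |MA| + 2 * (|MA| + MB + Mq) ^ 2, by positivity, fun u x hx => ?_⟩
  have h := lower_order (fun j => A x j) (∑ j, pdR j (fun y => A y j) x) (q x) (u x)
    (fun j => pd j u x) (MA := |MA|) (MB := MB) (Mq := Mq)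
    ((hMA ⟨x, subset_closure hx, rfl⟩).trans (le_abs_self _)) (hMB ⟨x, subset_closure hx, rfl⟩) (hMq x hx)
  refine le_trans (le_of_eq ?_) h
  congr 2
  unfold Lmag
  push_cast
  ring

lemma Lmag_meas {Ω U : Set (En n)} (hΩo : IsOpen Ω) (hU : IsOpen U)
    (hΩU : closure Ω ⊆ U) (A : En n → En n) (hA : ContDiffOn ℝ 1 A U)
    (q : En n → ℂ) (hqm : Measurable q) (u : En n → ℂ) (hu : ContDiff ℝ (⊤ : ℕ∞) u) :
    AEStronglyMeasurable (Lmag A q u) (volume.restrict Ω) := by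
  have hΩU' : Ω ⊆ U := subset_closure.trans hΩU
  have hAj : ∀ j, ContDiffOn ℝ 1 (fun y => A y j) U := fun j =>
    (contDiffOn_euclidean (𝕜 := ℝ)).1 hA j
  have hAc : ∀ j, ContinuousOn (fun y => ((A y j : ℝ) : ℂ)) Ω := fun j =>
    Complex.continuous_ofReal.comp_continuousOn ((hAj j).continuousOn.mono hΩU')
  have hdA : ∀ j, ContinuousOn (fun x => ((pdR j (fun y => A y j) x : ℝ) : ℂ)) Ω := fun j =>
    Complex.continuous_ofReal.comp_continuousOn
     ((((hAj j).continuousOn_fderiv_of_isOpen hU le_rfl).clm_apply continuousOn_const).mono hΩU')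
  have hA2 : ContinuousOn (fun x => (((∑ j, (A x j) ^ 2 : ℝ)) : ℂ)) Ω :=
    Complex.continuous_ofReal.comp_continuousOn
      ((continuousOn_finsetSum Finset.univ fun j _ => ((hAj j).continuousOn.pow 2)).mono hΩU')
  have huc := hu.continuous
  have h1 : Continuous fun x => ∑ j, pd j (pd j u) x :=
    continuous_finsetSum _ fun j _ => (pd_smooth (pd_smooth hu j) j).continuous
  have h2 : ContinuousOn (fun x => ∑ j, (A x j : ℂ) * pd j u x) Ω :=
    continuousOn_finsetSum _ fun j _ => (hAc j).mul (pd_smooth hu j).continuous.continuousOn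
  have h3 : ContinuousOn (fun x => ∑ j, (pdR j (fun y => A y j) x : ℂ)) Ω :=
    continuousOn_finsetSum _ fun j _ => hdA j
  have hc : ContinuousOn (fun x => -(∑ j, pd j (pd j u) x) - 2 * I * (∑ j, (A x j : ℂ) * pd j u x)
    - I * (∑ j, (pdR j (fun y => A y j) x : ℂ)) * u x) Ω :=
    ((h1.neg.continuousOn).sub (continuousOn_const.mul h2)).sub
      ((continuousOn_const.mul h3).mul huc.continuousOn)
  unfold Lmag
  refine (hc.aestronglyMeasurable hΩo.measurableSet).add ?_
  exact ((hA2.aestronglyMeasurable hΩo.measurableSet).add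
    hqm.aestronglyMeasurable).mul huc.aestronglyMeasurable

end main

/-- **Carleman estimate.** For a limiting Carleman weight `φ` there are `C, h₀ > 0` with
`‖e^{φ/h}u‖ + h‖e^{φ/h}∇u‖ ≤ C h ‖e^{φ/h} L_{A,q} u‖` for all `u ∈ C_c^∞(Ω)`, `0 < h ≤ h₀`. -/
theorem carleman_estimate {n : ℕ} (Ω U : Set (En n)) (hΩo : IsOpen Ω)
    (hΩb : Bornology.IsBounded Ω) (hU : IsOpen U) (hΩU : closure Ω ⊆ U)
    (φ : En n → ℝ) (hφ : ContDiffOn ℝ (⊤ : ℕ∞) φ U)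
    (hgrad : ∀ x ∈ U, gradient φ x ≠ 0)
    (hlcw : ∀ x ∈ U, ∀ ξ : En n, ‖ξ‖ ^ 2 = ‖gradient φ x‖ ^ 2 → ⟪gradient φ x, ξ⟫ = 0 →
      hess φ x (gradient φ x) (gradient φ x) + hess φ x ξ ξ = 0)
    (A : En n → En n) (hA : ContDiffOn ℝ 1 A U)
    (q : En n → ℂ) (hq : ∃ M, ∀ x ∈ Ω, ‖q x‖ ≤ M) (hqm : Measurable q) :
    ∃ C > (0 : ℝ), ∃ h₀ > (0 : ℝ), ∀ h : ℝ, 0 < h → h ≤ h₀ →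
      ∀ u : En n → ℂ, ContDiff ℝ (⊤ : ℕ∞) u → HasCompactSupport u → tsupport u ⊆ Ω →
        Real.sqrt (∫ x in Ω, Real.exp (2 * φ x / h) * ‖u x‖ ^ 2)
          + h * Real.sqrt (∫ x in Ω, Real.exp (2 * φ x / h) * ∑ j, ‖pd j u x‖ ^ 2)
        ≤ C * h * Real.sqrt (∫ x in Ω, Real.exp (2 * φ x / h) * ‖Lmag A q u x‖ ^ 2) := by
  obtain ⟨Φ, hΦ, W, hWo, hΩW, hWU, hΦφ⟩ := ext_smooth hU hΩU hφ
  have hcoord : ∀ x ∈ W, _ := fun x hx => by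
    have hev : φ =ᶠ[nhds x] Φ := by
      filter_upwards [hWo.mem_nhds hx] with y hy using (hΦφ y hy).symm
    have hgr : gradient φ x = gradient Φ x := by
      unfold gradient; rw [hev.fderiv_eq]
    have hhe : ∀ v w, hess φ x v w = hess Φ x v w := by
      intro v w
      unfold hess
      have : (fun y => fderiv ℝ φ y v) =ᶠ[nhds x] fun y => fderiv ℝ Φ y v := by
        filter_upwards [hev.fderiv (𝕜 := ℝ)] with y hy
        rw [hy]
      rw [this.fderiv_eq]
    have h1 := hgrad x (hWU hx)
    have h2 := hlcw x (hWU hx)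
    simp only [hgr, hhe] at h1 h2
    exact lcw_coord hΦ x h1 h2
  obtain ⟨c, hc, M, hM, s₀, hs₀, hΦM, hcore⟩ := core_u hΩb hWo hΩW hΦ (fun x hx => (hcoord x hx).1)
    (fun x hx => (hcoord x hx).2)
  obtain ⟨K, hK, hLb⟩ := Lmag_bound hΩb hU hΩU A hA q hq
  set s := max s₀ ((2 * K + 1) / c) with hs
  have hs0 : s₀ ≤ s := le_max_left _ _
  have hs1 : 1 ≤ s := le_trans hs₀ hs0
  have hsc : 2 * K + 1 ≤ s * c := by
    have : (2 * K + 1) / c ≤ s := le_max_right _ _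
    rwa [div_le_iff₀ hc] at this
  have hsM : 1 ≤ s * M := by nlinarith
  set Q := 2 * Real.exp (s * M ^ 2) with hQ
  have hQ0 : 0 < Q := by positivity
  refine ⟨2 * Real.sqrt Q, by positivity, 1 / (32 * s * M), by positivity, ?_⟩
  intro h hh0 hh u hu huc hus
  set τ := 1 / h with hτ
  have hτ1 : 32 * s * M ≤ τ := by
    rw [hτ, le_div_iff₀ hh0]
    rw [le_div_iff₀ (by positivity)] at hh
    linarith
  have hτ2 : 1 ≤ τ := by linarith
  have hτsq : 1 ≤ τ ^ 2 := by nlinarith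
  have hsubre : tsupport (fun y => (u y).re) ⊆ tsupport u :=
    closure_mono fun x hx hx0 => hx (by simp [hx0])
  have hsubim : tsupport (fun y => (u y).im) ⊆ tsupport u :=
    closure_mono fun x hx hx0 => hx (by simp [hx0])
  obtain ⟨D1, hD1, h1⟩ := hcore s hs0 τ hτ1 _ rfl (fun y => (u y).re)
    (Complex.reCLM.contDiff.comp hu) (huc.of_isClosed_subset (isClosed_tsupport _) hsubre)
    (hsubre.trans hus)
  obtain ⟨D2, hD2, h2⟩ := hcore s hs0 τ hτ1 _ rfl (fun y => (u y).im)
    (Complex.imCLM.contDiff.comp hu) (huc.of_isClosed_subset (isClosed_tsupport _) hsubim)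
    (hsubim.trans hus)
  have hD := hD1.add hD2
  -- pointwise inequality
  have hpt : ∀ x ∈ Ω, (τ ^ 2 * (Real.exp (2 * φ x / h) * ‖u x‖ ^ 2)
      + Real.exp (2 * φ x / h) * ∑ j, ‖pd j u x‖ ^ 2) + (D1 x + D2 x)
      ≤ Q * (Real.exp (2 * φ x / h) * ‖Lmag A q u x‖ ^ 2) := by
    intro x hx
    have a1 := h1 x hx
    have a2 := h2 x hx
    obtain ⟨b1, b2⟩ := complex_split hu x
    have b3 := nsq (u x)
    have a3 := hLb u x hx
    have hxφ : Φ x = φ x := hΦφ x (hΩW (subset_closure hx))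
    rw [hxφ] at a1 a2
    have hφM : φ x ^ 2 ≤ M ^ 2 := by
      have := hΦM x hx
      rw [hxφ] at this
      rw [← sq_abs]; gcongr
    have hexp : Real.exp (2 * (τ * φ x + s / 2 * (φ x * φ x))) =
        Real.exp (2 * φ x / h) * Real.exp (s * φ x ^ 2) := by
      rw [← Real.exp_add, hτ]; congr 1; ring
    have he1 : 1 ≤ Real.exp (s * φ x ^ 2) := Real.one_le_exp (by positivity)
    have he2 : Real.exp (s * φ x ^ 2) ≤ Real.exp (s * M ^ 2) := Real.exp_le_exp.2 (by gcongr)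
    set e := Real.exp (2 * (τ * φ x + s / 2 * (φ x * φ x))) with he
    have he0 : 0 < e := Real.exp_pos _
    set p := Real.exp (2 * φ x / h) with hp
    have hp0 : 0 < p := Real.exp_pos _
    set Gd := ∑ j, ‖pd j u x‖ ^ 2 with hGd
    have hGd0 : 0 ≤ Gd := Finset.sum_nonneg fun j _ => sq_nonneg _
    set N := ‖u x‖ ^ 2 with hN
    have hN0 : 0 ≤ N := sq_nonneg _
    -- Laplacian bound
    have c1 : ‖∑ j, pd j (pd j u) x‖ ^ 2 ≤ 2 * ‖Lmag A q u x‖ ^ 2 + 2 * (K * (N + Gd)) := by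
      have t : ‖∑ j, pd j (pd j u) x‖ ≤ ‖Lmag A q u x + ∑ j, pd j (pd j u) x‖ + ‖Lmag A q u x‖ := by
        have := norm_sub_le (Lmag A q u x + ∑ j, pd j (pd j u) x) (Lmag A q u x)
        simpa using this
      have t2 := pow_le_pow_left₀ (norm_nonneg _) t 2
      linarith [sq_nonneg (‖Lmag A q u x + ∑ j, pd j (pd j u) x‖ - ‖Lmag A q u x‖)]
    have c2 : s * c * (e * (τ ^ 2 * N + Gd)) + (D1 x + D2 x) ≤ e * ‖∑ j, pd j (pd j u) x‖ ^ 2 := by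
      rw [b1, b2, b3]
      linarith
    have hNτ : N ≤ τ ^ 2 * N := by nlinarith
    have c3 : (2 * K + 1) * (e * (τ ^ 2 * N + Gd)) ≤ s * c * (e * (τ ^ 2 * N + Gd)) := by gcongr
    have c4 : e * ‖∑ j, pd j (pd j u) x‖ ^ 2 ≤ e * (2 * ‖Lmag A q u x‖ ^ 2 + 2 * (K * (τ ^ 2 * N + Gd))) := by
      refine mul_le_mul_of_nonneg_left (c1.trans ?_) he0.le
      gcongr
    have c5 : e * (τ ^ 2 * N + Gd) + (D1 x + D2 x) ≤ 2 * e * ‖Lmag A q u x‖ ^ 2 := by linarith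
    have c6 : p ≤ e := by rw [hexp]; exact le_mul_of_one_le_right hp0.le he1
    have c7 : 2 * e ≤ Q * p := by
      rw [hexp, hQ]
      have := mul_le_mul_of_nonneg_left he2 hp0.le
      linarith
    have c8 : p * (τ ^ 2 * N + Gd) ≤ e * (τ ^ 2 * N + Gd) := by gcongr
    have c9 : 2 * e * ‖Lmag A q u x‖ ^ 2 ≤ Q * p * ‖Lmag A q u x‖ ^ 2 := by gcongr
    linarith
  -- integrability
  have hcpt := hΩb.isCompact_closure
  have hφc : ContinuousOn (fun x => Real.exp (2 * φ x / h)) (closure Ω) := by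
    refine Real.continuous_exp.comp_continuousOn ?_
    exact (continuousOn_const.mul (hφ.continuousOn.mono hΩU)).div_const _
  have hint : ∀ f : En n → ℝ, Continuous f →
      IntegrableOn (fun x => Real.exp (2 * φ x / h) * f x) Ω := fun f hf =>
    ((hφc.mul hf.continuousOn).integrableOn_compact hcpt).mono_set subset_closure
  have hcN : Continuous fun x => ‖u x‖ ^ 2 := hu.continuous.norm.pow 2
  have hcG : Continuous fun x => ∑ j, ‖pd j u x‖ ^ 2 :=
    continuous_finsetSum _ fun j _ => (pd_smooth hu j).continuous.norm.pow 2
  have hcL : Continuous fun x => ‖∑ j, pd j (pd j u) x‖ ^ 2 :=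
    (continuous_finsetSum _ fun j _ => (pd_smooth (pd_smooth hu j) j).continuous).norm.pow 2
  have hiN := hint _ hcN
  have hiG := hint _ hcG
  have hiL : IntegrableOn (fun x => Real.exp (2 * φ x / h) * ‖Lmag A q u x‖ ^ 2) Ω := by
    have hdom := hint _ ((hcL.const_mul 2).add (((hcN.add hcG).const_mul K).const_mul 2))
    refine Integrable.mono' hdom ?_ ?_
    · refine ((hφc.mono subset_closure).aestronglyMeasurable hΩo.measurableSet).mul ?_
      exact (Lmag_meas hΩo hU hΩU A hA q hqm u hu).norm.pow 2
    · refine (ae_restrict_iff' hΩo.measurableSet).2 (Filter.Eventually.of_forall fun x hx => ?_)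
      rw [Real.norm_of_nonneg (by positivity)]
      refine mul_le_mul_of_nonneg_left ?_ (Real.exp_pos _).le
      simp only [Pi.add_apply]
      have a3 := hLb u x hx
      have t : ‖Lmag A q u x‖ ≤ ‖Lmag A q u x + ∑ j, pd j (pd j u) x‖ + ‖∑ j, pd j (pd j u) x‖ := by
        have := norm_sub_le (Lmag A q u x + ∑ j, pd j (pd j u) x) (∑ j, pd j (pd j u) x)
        simpa using this
      have t2 := pow_le_pow_left₀ (norm_nonneg _) t 2
      linarith [sq_nonneg (‖Lmag A q u x + ∑ j, pd j (pd j u) x‖ - ‖∑ j, pd j (pd j u) x‖)]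
  have hDΩ : ∫ x in Ω, (D1 x + D2 x) = 0 := by
    rw [setIntegral_eq_integral_of_forall_compl_eq_zero (fun x hx => hD.2.2 x hx)]
    exact hD.2.1
  have hI := setIntegral_mono_on (((hiN.const_mul (τ ^ 2)).add hiG).add hD.1.integrableOn)
    (hiL.const_mul Q) hΩo.measurableSet hpt
  have hI2 : τ ^ 2 * (∫ x in Ω, Real.exp (2 * φ x / h) * ‖u x‖ ^ 2)
      + (∫ x in Ω, Real.exp (2 * φ x / h) * ∑ j, ‖pd j u x‖ ^ 2)
      ≤ Q * ∫ x in Ω, Real.exp (2 * φ x / h) * ‖Lmag A q u x‖ ^ 2 := by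
    rw [integral_const_mul] at hI
    have e1 : ∫ x in Ω, ((τ ^ 2 * (Real.exp (2 * φ x / h) * ‖u x‖ ^ 2)
      + Real.exp (2 * φ x / h) * ∑ j, ‖pd j u x‖ ^ 2) + (D1 x + D2 x)) = _ :=
      integral_add ((hiN.const_mul (τ ^ 2)).add hiG) hD.1.integrableOn
    have e2 : ∫ x in Ω, (τ ^ 2 * (Real.exp (2 * φ x / h) * ‖u x‖ ^ 2)
      + Real.exp (2 * φ x / h) * ∑ j, ‖pd j u x‖ ^ 2) = _ :=
      integral_add (hiN.const_mul (τ ^ 2)) hiG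
    rw [integral_const_mul] at e2
    rw [← e2]
    refine le_trans (le_of_eq ?_) hI
    refine Eq.trans ?_ e1.symm
    rw [hDΩ, add_zero]
  have hX0 : 0 ≤ ∫ x in Ω, Real.exp (2 * φ x / h) * ‖u x‖ ^ 2 :=
    integral_nonneg fun x => by positivity
  have hG0 : 0 ≤ ∫ x in Ω, Real.exp (2 * φ x / h) * ∑ j, ‖pd j u x‖ ^ 2 :=
    integral_nonneg fun x => by positivity
  generalize (∫ x in Ω, Real.exp (2 * φ x / h) * ‖u x‖ ^ 2) = X at hI2 hX0 ⊢
  generalize (∫ x in Ω, Real.exp (2 * φ x / h) * ∑ j, ‖pd j u x‖ ^ 2) = G at hI2 hG0 ⊢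
  generalize (∫ x in Ω, Real.exp (2 * φ x / h) * ‖Lmag A q u x‖ ^ 2) = Y at hI2 ⊢
  have hτh : τ * h = 1 := by rw [hτ]; field_simp
  have f1 : Real.sqrt X ≤ h * (Real.sqrt Q * Real.sqrt Y) := by
    rw [← Real.sqrt_mul hQ0.le, ← Real.sqrt_sq hh0.le, ← Real.sqrt_mul (sq_nonneg _)]
    refine Real.sqrt_le_sqrt ?_
    have : τ ^ 2 * X ≤ Q * Y := by linarith
    have := mul_le_mul_of_nonneg_left this (sq_nonneg h)
    calc X = h ^ 2 * (τ ^ 2 * X) := by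
          rw [← mul_assoc, ← mul_pow, mul_comm h, hτh]; ring
      _ ≤ _ := this
  have f2 : Real.sqrt G ≤ Real.sqrt Q * Real.sqrt Y := by
    rw [← Real.sqrt_mul hQ0.le]
    refine Real.sqrt_le_sqrt ?_
    have : 0 ≤ τ ^ 2 * X := by positivity
    linarith
  have f3 := mul_le_mul_of_nonneg_left f2 hh0.le
  linarith
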